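/- Let V ∈ L¹(ℝ³) be real-valued and k ∈ ℂ with Im(k) > 0. Then the operator with integral kernel (g_k(x−y) − g_k(x))|V(y)|^{1/2}, i.e. (−Δ − k²)^{-1}|V|^{1/2} − |g_k⟩⟨|V|^{1/2}|, is Hilbert–Schmidt with squared Hilbert–Schmidt norm at most (1/(4π))(1 + |Re(k)|/(2 Im(k))) ∫_{ℝ³} |V(x)| |x| dx. -/

import Mathlib

open MeasureTheory
noncomputable section

abbrev E3 := EuclideanSpace ℝ (Fin 3)

/-- `g_k(x) = e^{ik|x|}/(4π|x|)`. -/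
def gk (k : ℂ) (x : E3) : ℂ := Complex.exp (Complex.I * k * ‖x‖) / (4 * Real.pi * ‖x‖)

section Aux
open MeasureTheory Set

lemma exists_cyl (y : E3) (hy : y ≠ 0) :
    ∃ Φ : E3 ≃ᵐ ℝ × EuclideanSpace ℝ (Fin 2), MeasurePreserving Φ volume volume ∧
      (∀ x, ‖x‖ = Real.sqrt ((Φ x).1 ^ 2 + ‖(Φ x).2‖ ^ 2)) ∧
      (∀ x, ‖x - y‖ = Real.sqrt (((Φ x).1 - ‖y‖) ^ 2 + ‖(Φ x).2‖ ^ 2)) := by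
  have hn : ‖y‖ ≠ 0 := norm_ne_zero_iff.2 hy
  obtain ⟨b, hb⟩ := Orthonormal.exists_orthonormalBasis_extension_of_card_eq (𝕜 := ℝ) (E := E3)
    (ι := Fin 3) (by simp) (v := fun _ => ‖y‖⁻¹ • y) (s := {0}) (by
      rw [orthonormal_iff_ite]
      rintro ⟨i, hi⟩ ⟨j, hj⟩
      simp only [mem_singleton_iff] at hi hj
      subst hi; subst hj
      simp only [Set.domRestrict, if_true, real_inner_self_eq_norm_sq, norm_smul, norm_inv, norm_norm]
      rw [inv_mul_cancel₀ hn, one_pow])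
  have hb0 : b 0 = ‖y‖⁻¹ • y := hb 0 rfl
  have hyb : y = ‖y‖ • b 0 := by rw [hb0, smul_smul, mul_inv_cancel₀ hn, one_smul]
  have hry : b.repr y = EuclideanSpace.single 0 ‖y‖ := by
    conv_lhs => rw [hyb]
    rw [map_smul, b.repr_self]
    ext i; simp
  let e1 := b.measurableEquiv
  let e2 := (MeasurableEquiv.toLp 2 (Fin 3 → ℝ)).symm
  let e3 := MeasurableEquiv.piFinSuccAbove (fun _ : Fin 3 => ℝ) 0
  let e4 : (ℝ × (Fin 2 → ℝ)) ≃ᵐ ℝ × EuclideanSpace ℝ (Fin 2) :=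
    (MeasurableEquiv.refl ℝ).prodCongr (MeasurableEquiv.toLp 2 (Fin 2 → ℝ))
  have key : ∀ z : E3, ‖z‖ = Real.sqrt ((e4 (e3 (e2 (e1 z)))).1 ^ 2 + ‖(e4 (e3 (e2 (e1 z)))).2‖ ^ 2) := by
    intro z
    rw [← b.repr.norm_map z, EuclideanSpace.norm_eq, EuclideanSpace.norm_eq,
      Real.sq_sqrt (by positivity), Fin.sum_univ_succ]
    simp only [Real.norm_eq_abs, sq_abs]
    rfl
  refine ⟨((e1.trans e2).trans e3).trans e4, ?_, key, ?_⟩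
  · have h4 : MeasurePreserving e4 volume volume :=
      (MeasurePreserving.id volume).prod (PiLp.volume_preserving_toLp (Fin 2))
    exact h4.comp ((volume_preserving_piFinSuccAbove (fun _ : Fin 3 => ℝ) 0).comp
      ((PiLp.volume_preserving_ofLp (Fin 3)).comp b.measurePreserving_measurableEquiv))
  · intro x
    rw [key (x - y)]
    have h1 : (e4 (e3 (e2 (e1 (x - y))))).1 = (e4 (e3 (e2 (e1 x)))).1 - ‖y‖ := by
      change b.repr (x - y) 0 = b.repr x 0 - ‖y‖
      rw [map_sub, hry]; simp
    have h2 : (e4 (e3 (e2 (e1 (x - y))))).2 = (e4 (e3 (e2 (e1 x)))).2 := by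
      ext i
      change b.repr (x - y) (Fin.succ i) = b.repr x (Fin.succ i)
      rw [map_sub, hry]; simp
    rw [h1, h2]; rfl

lemma integral_radial2 (h : ℝ → ℝ) :
    ∫ w : EuclideanSpace ℝ (Fin 2), h (‖w‖ ^ 2) = Real.pi * ∫ u in Ioi (0:ℝ), h u := by
  have := integral_fun_norm_addHaar (volume : Measure (EuclideanSpace ℝ (Fin 2)))
    (fun r => h (r ^ 2))
  rw [this, ← integral_comp_rpow_Ioi_of_pos (g := h) (p := 2) two_pos]
  simp only [finrank_euclideanSpace, Fintype.card_fin, Measure.real,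
    EuclideanSpace.volume_ball_fin_two]
  have h2 : ∫ x in Ioi (0:ℝ), (2 * x ^ ((2:ℝ) - 1)) • h (x ^ (2:ℝ)) =
      2 * ∫ y in Ioi (0:ℝ), y ^ (2 - 1) • h (y ^ 2) := by
    rw [← integral_const_mul]
    refine setIntegral_congr_fun measurableSet_Ioi fun x hx => ?_
    norm_num
    ring
  rw [h2]
  simp [Real.pi_pos.le]
  ring

def prol (c : ℝ) (q : ℝ × ℝ) : ℝ × ℝ :=
  (c * (q.1 * q.2), c ^ 2 * ((q.1 ^ 2 - 1) * (1 - q.2 ^ 2)))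

def prol' (c : ℝ) (q : ℝ × ℝ) : ℝ × ℝ →L[ℝ] ℝ × ℝ :=
  (Matrix.toLin (.finTwoProd ℝ) (.finTwoProd ℝ)
    !![c * q.2, c * q.1; c ^ 2 * (2 * q.1 * (1 - q.2 ^ 2)),
      c ^ 2 * ((q.1 ^ 2 - 1) * (- (2 * q.2)))]).toContinuousLinearMap

lemma prol_deriv (c : ℝ) (q : ℝ × ℝ) : HasFDerivAt (prol c) (prol' c q) q := by
  unfold prol'
  rw [Matrix.toLin_finTwoProd_toContinuousLinearMap]
  have h1 : HasFDerivAt (fun q : ℝ × ℝ => q.1) (ContinuousLinearMap.fst ℝ ℝ ℝ) q := hasFDerivAt_fst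
  have h2 : HasFDerivAt (fun q : ℝ × ℝ => q.2) (ContinuousLinearMap.snd ℝ ℝ ℝ) q := hasFDerivAt_snd
  have := HasFDerivAt.prodMk ((h1.mul h2).const_mul c)
    ((((h1.pow 2).sub_const 1).mul ((h2.pow 2).const_sub 1)).const_mul (c ^ 2))
  refine this.congr_fderiv ?_
  ext <;> simp
  left; ring

lemma prol_det (c : ℝ) (q : ℝ × ℝ) : (prol' c q).det = -(2 * c ^ 3 * (q.1 ^ 2 - q.2 ^ 2)) := by
  simp only [prol', LinearMap.det_toContinuousLinearMap, LinearMap.det_toLin, Matrix.det_fin_two_of]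
  ring

def PS : Set (ℝ × ℝ) := Ioi 1 ×ˢ Ioo (-1) 1

lemma prol_r (c : ℝ) (hc : 0 < c) (q : ℝ × ℝ) (hq : q ∈ PS) :
    Real.sqrt (((prol c q).1 + c) ^ 2 + (prol c q).2) = c * (q.1 + q.2) := by
  obtain ⟨h1, h2, h3⟩ := hq
  simp only [mem_Ioi] at h1
  rw [Real.sqrt_eq_iff_mul_self_eq_of_pos (mul_pos hc (by linarith))]
  simp [prol]; ring

lemma prol_s (c : ℝ) (hc : 0 < c) (q : ℝ × ℝ) (hq : q ∈ PS) :
    Real.sqrt (((prol c q).1 - c) ^ 2 + (prol c q).2) = c * (q.1 - q.2) := by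
  obtain ⟨h1, h2, h3⟩ := hq
  simp only [mem_Ioi] at h1
  rw [Real.sqrt_eq_iff_mul_self_eq_of_pos (mul_pos hc (by linarith))]
  simp [prol]; ring

lemma prol_inj (c : ℝ) (hc : 0 < c) : InjOn (prol c) PS := by
  intro p hp q hq h
  have e1 := prol_r c hc p hp
  have e2 := prol_s c hc p hp
  rw [h, prol_r c hc q hq] at e1
  rw [h, prol_s c hc q hq] at e2
  have e1 := mul_left_cancel₀ hc.ne' e1
  have e2 := mul_left_cancel₀ hc.ne' e2
  ext <;> linarith

lemma prol_image (c : ℝ) (hc : 0 < c) : prol c '' PS = univ ×ˢ Ioi 0 := by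
  ext ⟨t, u⟩
  simp only [mem_image, mem_prod, mem_univ, true_and, mem_Ioi]
  constructor
  · rintro ⟨⟨a, b⟩, ⟨h1, h2, h3⟩, h⟩
    simp only [mem_Ioi] at h1 h2 h3
    have : u = c ^ 2 * ((a ^ 2 - 1) * (1 - b ^ 2)) := by rw [prol] at h; exact (congrArg Prod.snd h).symm
    rw [this]
    have : 0 < a ^ 2 - 1 := by nlinarith
    have : 0 < 1 - b ^ 2 := by nlinarith
    positivity
  · intro hu
    set r := Real.sqrt ((t + c) ^ 2 + u) with hr
    set s := Real.sqrt ((t - c) ^ 2 + u) with hs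
    have r2 : r ^ 2 = (t + c) ^ 2 + u := Real.sq_sqrt (by positivity)
    have s2 : s ^ 2 = (t - c) ^ 2 + u := Real.sq_sqrt (by positivity)
    have r0 : |t + c| < r := by
      rw [hr]; apply Real.lt_sqrt_of_sq_lt; rw [sq_abs]; linarith
    have s0 : |t - c| < s := by
      rw [hs]; apply Real.lt_sqrt_of_sq_lt; rw [sq_abs]; linarith
    have r1 := abs_lt.1 r0
    have s1 := abs_lt.1 s0
    have hsum : 2 * c < r + s := by linarith
    have d1 : r - s < 2 * c := by
      by_contra! hh
      nlinarith
    have d2 : s - r < 2 * c := by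
      by_contra! hh
      nlinarith
    have er : r = Real.sqrt ((t + c) ^ 2 + u) := rfl
    refine ⟨((r + s) / (2 * c), (r - s) / (2 * c)), ⟨?_, ?_, ?_⟩, ?_⟩
    · simp only [mem_Ioi]; rw [lt_div_iff₀ (by positivity)]; linarith
    · simp only; rw [lt_div_iff₀ (by positivity)]; linarith
    · simp only; rw [div_lt_iff₀ (by positivity)]; linarith
    · clear_value r s
      have ht : t = (r ^ 2 - s ^ 2) / (4 * c) := by rw [r2, s2]; field_simp; ring
      have huu : u = (r ^ 2 + s ^ 2) / 2 - t ^ 2 - c ^ 2 := by rw [r2, s2]; ring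
      simp only [prol, Prod.mk.injEq]
      constructor
      · rw [ht]; field_simp; ring
      · rw [huu, ht]; field_simp; ring

lemma PS_meas : MeasurableSet PS := measurableSet_Ioi.prod measurableSet_Ioo

lemma prolate_integral (y : E3) (hy : y ≠ 0) (c : ℝ) (hc : ‖y‖ = 2 * c) (f : ℝ → ℝ → ℝ)
    (hf : Integrable (fun x : E3 => f ‖x‖ ‖x - y‖))
    (hf' : IntegrableOn (fun q : ℝ × ℝ =>
      (2 * c ^ 3 * (q.1 ^ 2 - q.2 ^ 2)) * f (c * (q.1 + q.2)) (c * (q.1 - q.2))) PS) :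
    ∫ x : E3, f ‖x‖ ‖x - y‖ = Real.pi * ∫ q in PS,
      (2 * c ^ 3 * (q.1 ^ 2 - q.2 ^ 2)) * f (c * (q.1 + q.2)) (c * (q.1 - q.2)) := by
  have hc0 : 0 < c := by have := norm_pos_iff.2 hy; linarith
  obtain ⟨Φ, hΦ, n1, n2⟩ := exists_cyl y hy
  let F : ℝ × EuclideanSpace ℝ (Fin 2) → ℝ := fun p =>
    f (Real.sqrt (p.1 ^ 2 + ‖p.2‖ ^ 2)) (Real.sqrt ((p.1 - ‖y‖) ^ 2 + ‖p.2‖ ^ 2))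
  have hF : (fun x : E3 => f ‖x‖ ‖x - y‖) = F ∘ Φ := by
    funext x; simp only [F, Function.comp]; rw [n1 x, n2 x]
  have hFi : Integrable F := by
    rw [hF] at hf
    exact (hΦ.integrable_comp_emb Φ.measurableEmbedding).1 hf
  have e1 : ∫ x : E3, f ‖x‖ ‖x - y‖ = ∫ p, F p := by
    rw [← hΦ.integral_comp Φ.measurableEmbedding]
    exact congrArg (fun g : E3 → ℝ => ∫ x, g x) hF
  let G : ℝ × ℝ → ℝ := fun p =>
    f (Real.sqrt ((p.1 + c) ^ 2 + p.2)) (Real.sqrt ((p.1 - c) ^ 2 + p.2))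
  have e2 : ∫ p, F p = ∫ t, Real.pi * ∫ u in Ioi (0:ℝ), G (t, u) := by
    rw [Measure.volume_eq_prod, integral_prod _ hFi, ← integral_add_right_eq_self _ c]
    congr 1; funext t
    rw [← integral_radial2]
    simp only [F, G, hc]
    congr 1; funext w
    congr 3; ring
  have hcong : EqOn (fun q : ℝ × ℝ => |(prol' c q).det| • G (prol c q)) (fun q : ℝ × ℝ =>
      (2 * c ^ 3 * (q.1 ^ 2 - q.2 ^ 2)) * f (c * (q.1 + q.2)) (c * (q.1 - q.2))) PS := by
    intro q hq
    simp only [G]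
    rw [prol_r c hc0 q hq, prol_s c hc0 q hq, prol_det, abs_neg, abs_of_nonneg, smul_eq_mul]
    obtain ⟨h1, h2, h3⟩ := hq
    simp only [mem_Ioi] at h1
    have : 0 ≤ q.1 ^ 2 - q.2 ^ 2 := by nlinarith
    positivity
  have hGi : IntegrableOn G (univ ×ˢ Ioi 0) := by
    rw [← prol_image c hc0, integrableOn_image_iff_integrableOn_abs_det_fderiv_smul volume PS_meas
      (fun q _ => (prol_deriv c q).hasFDerivWithinAt) (prol_inj c hc0)]
    exact hf'.congr_fun hcong.symm PS_meas
  rw [e1, e2, integral_const_mul]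
  congr 1
  rw [← setIntegral_congr_fun PS_meas hcong,
    ← integral_image_eq_integral_abs_det_fderiv_smul volume PS_meas
      (fun q _ => (prol_deriv c q).hasFDerivWithinAt) (prol_inj c hc0), prol_image c hc0,
    Measure.volume_eq_prod, setIntegral_prod _ hGi]
  simp

/-- The radial amplitude of `gk`. -/
def amp (κ r : ℝ) : ℝ := Real.exp (-(κ * r)) / (4 * Real.pi * r)

lemma gk_re_im (k : ℂ) (x : E3) : gk k x =
    ((amp k.im ‖x‖ * Real.cos (k.re * ‖x‖) : ℝ) : ℂ) +
      ((amp k.im ‖x‖ * Real.sin (k.re * ‖x‖) : ℝ) : ℂ) * Complex.I := by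
  have h : Complex.I * k * ‖x‖ = ((-(k.im * ‖x‖) : ℝ) : ℂ) + ((k.re * ‖x‖ : ℝ) : ℂ) * Complex.I := by
    apply Complex.ext <;> simp
  unfold gk amp
  rw [h, Complex.exp_add, Complex.exp_mul_I]
  push_cast
  ring

lemma gk_diff (k : ℂ) (x z : E3) : ‖gk k x - gk k z‖ ^ 2 =
    amp k.im ‖x‖ ^ 2 + amp k.im ‖z‖ ^ 2 -
      2 * (amp k.im ‖x‖ * amp k.im ‖z‖ * Real.cos (k.re * (‖z‖ - ‖x‖))) := by
  rw [gk_re_im k x, gk_re_im k z, ← Complex.normSq_eq_norm_sq, Complex.normSq_apply]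
  simp only [Complex.sub_re, Complex.sub_im, Complex.add_re, Complex.add_im, Complex.ofReal_re,
    Complex.ofReal_im, Complex.re_ofReal_mul, Complex.im_ofReal_mul, Complex.I_re, Complex.I_im]
  rw [mul_sub k.re, Real.cos_sub]
  have h1 := Real.sin_sq_add_cos_sq (k.re * ‖x‖)
  have h2 := Real.sin_sq_add_cos_sq (k.re * ‖z‖)
  linear_combination (amp k.im ‖x‖) ^ 2 * h1 + (amp k.im ‖z‖) ^ 2 * h2

lemma amp_eqOn (κ : ℝ) : EqOn (fun y : ℝ => y ^ (3 - 1) • amp κ y ^ 2)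
    (fun y => (1 / (16 * Real.pi ^ 2)) * Real.exp ((-(2 * κ)) * y)) (Ioi 0) := by
  intro y hy
  simp only [mem_Ioi] at hy
  have : Real.exp (-(2 * κ) * y) = Real.exp (-(κ * y)) ^ 2 := by
    rw [← Real.exp_nat_mul]; congr 1; push_cast; ring
  simp only [amp, smul_eq_mul, this]
  have := Real.pi_pos
  field_simp
  norm_num

lemma amp_integrable (κ : ℝ) (hκ : 0 < κ) : Integrable (fun x : E3 => amp κ ‖x‖ ^ 2) := by
  rw [integrable_fun_norm_addHaar volume (f := fun r => amp κ r ^ 2)]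
  simp only [finrank_euclideanSpace, Fintype.card_fin]
  refine IntegrableOn.congr_fun ?_ (amp_eqOn κ).symm measurableSet_Ioi
  exact (integrableOn_exp_mul_Ioi (by linarith) 0).const_mul _

lemma amp_integral (κ : ℝ) (hκ : 0 < κ) :
    ∫ x : E3, amp κ ‖x‖ ^ 2 = 1 / (8 * Real.pi * κ) := by
  rw [integral_fun_norm_addHaar volume (fun r => amp κ r ^ 2)]
  simp only [finrank_euclideanSpace, Fintype.card_fin, Measure.real]
  rw [setIntegral_congr_fun measurableSet_Ioi (amp_eqOn κ), integral_const_mul,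
    integral_exp_mul_Ioi (by linarith) 0, EuclideanSpace.volume_ball_fin_three]
  have := Real.pi_pos
  simp only [ENNReal.ofReal_one, one_pow, one_mul, mul_zero, Real.exp_zero, smul_eq_mul,
    nsmul_eq_mul]
  rw [ENNReal.toReal_ofReal (by positivity)]
  norm_num
  field_simp
  norm_num

lemma amp_meas (κ : ℝ) : Measurable (amp κ) := by
  unfold amp; fun_prop

lemma cross_integrable (κ a : ℝ) (hκ : 0 < κ) (y : E3) :
    Integrable (fun x : E3 => amp κ ‖x‖ * amp κ ‖x - y‖ * Real.cos (a * (‖x‖ - ‖x - y‖))) := by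
  have h1 := amp_integrable κ hκ
  have h2 : Integrable (fun x : E3 => amp κ ‖x - y‖ ^ 2) := h1.comp_sub_right y
  refine (h1.add h2).mono' ?_ ?_
  · have := amp_meas κ
    apply Measurable.aestronglyMeasurable
    fun_prop
  · refine Filter.Eventually.of_forall fun x => ?_
    simp only [Pi.add_apply, norm_mul, Real.norm_eq_abs]
    have hc := Real.abs_cos_le_one (a * (‖x‖ - ‖x - y‖))
    have : |amp κ ‖x‖| * |amp κ ‖x - y‖| * |Real.cos (a * (‖x‖ - ‖x - y‖))| ≤
      |amp κ ‖x‖| * |amp κ ‖x - y‖| := mul_le_of_le_one_right (by positivity) hc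
    rw [← sq_abs (amp κ ‖x‖), ← sq_abs (amp κ ‖x - y‖)]
    nlinarith [sq_nonneg (|amp κ ‖x‖| - |amp κ ‖x - y‖|), sq_nonneg (|amp κ ‖x‖|),
      sq_nonneg (|amp κ ‖x - y‖|)]

lemma cos_int (t : ℝ) : 2 - |t| ≤ ∫ η in Ioo (-1:ℝ) 1, Real.cos (t * η) := by
  rw [← integral_Ioc_eq_integral_Ioo, ← intervalIntegral.integral_of_le (by norm_num)]
  by_cases ht : t = 0
  · subst ht; norm_num
  have h0 : (∫ η in (-1:ℝ)..1, Real.cos (t * η)) = ∫ η in (-1:ℝ)..1, Real.cos (|t| * η) := by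
    congr 1; funext η
    rcases abs_choice t with h | h <;> rw [h]
    rw [neg_mul, Real.cos_neg]
  have hp : 0 < |t| := abs_pos.2 ht
  rw [h0]
  generalize |t| = s at hp
  rw [intervalIntegral.integral_comp_mul_left (fun x => Real.cos x) hp.ne', integral_cos, smul_eq_mul]
  have h1 := Real.sin_gt_sub_cube hp
  have h2 := Real.neg_one_le_sin s
  have h3 : s - s ^ 2 / 2 ≤ Real.sin s := by
    rcases le_total s 3 with h | h
    · nlinarith [mul_nonneg (sq_nonneg s) (sub_nonneg.2 h)]
    · nlinarith
  rw [mul_one, mul_neg_one, Real.sin_neg, ← div_eq_inv_mul, le_div_iff₀ hp]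
  nlinarith

lemma cross_lower (κ a : ℝ) (hκ : 0 < κ) (y : E3) (hy : y ≠ 0) :
    1 / (8 * Real.pi * κ) * (Real.exp (-(κ * ‖y‖)) * (1 - |a| * ‖y‖ / 2)) ≤
    ∫ x : E3, amp κ ‖x‖ * amp κ ‖x - y‖ * Real.cos (a * (‖x‖ - ‖x - y‖)) := by
  obtain ⟨c, hc⟩ : ∃ c, ‖y‖ = 2 * c := ⟨‖y‖ / 2, by ring⟩
  have hc0 : 0 < c := by have := norm_pos_iff.2 hy; linarith
  have hpi := Real.pi_pos
  have hE : EqOn (fun q : ℝ × ℝ => (2 * c ^ 3 * (q.1 ^ 2 - q.2 ^ 2)) *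
      (amp κ (c * (q.1 + q.2)) * amp κ (c * (q.1 - q.2)) *
        Real.cos (a * (c * (q.1 + q.2) - c * (q.1 - q.2)))))
      (fun q => (c / (8 * Real.pi ^ 2)) *
        (Real.exp ((-(2 * κ * c)) * q.1) * Real.cos ((2 * a * c) * q.2))) PS := by
    intro q hq
    obtain ⟨h1, h2, h3⟩ := hq
    simp only [mem_Ioi] at h1
    have p1 : 0 < q.1 + q.2 := by linarith
    have p2 : 0 < q.1 - q.2 := by linarith
    have e1 : Real.exp (-(2 * κ * c) * q.1) =
        Real.exp (-(κ * (c * (q.1 + q.2)))) * Real.exp (-(κ * (c * (q.1 - q.2)))) := by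
      rw [← Real.exp_add]; congr 1; ring
    have e2 : a * (c * (q.1 + q.2) - c * (q.1 - q.2)) = 2 * a * c * q.2 := by ring
    have e3 : q.1 ^ 2 - q.2 ^ 2 = (q.1 + q.2) * (q.1 - q.2) := by ring
    simp only [amp]
    rw [e1, e2, e3]
    field_simp
    ring
  have hi1 : IntegrableOn (fun ξ : ℝ => Real.exp ((-(2 * κ * c)) * ξ)) (Ioi 1) :=
    integrableOn_exp_mul_Ioi (by have := mul_pos hκ hc0; linarith) 1
  have hi2 : IntegrableOn (fun η : ℝ => Real.cos ((2 * a * c) * η)) (Ioo (-1) 1) := by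
    refine IntegrableOn.mono_set (t := Icc (-1) 1) ?_ Ioo_subset_Icc_self
    exact (Continuous.continuousOn (by fun_prop)).integrableOn_Icc
  have hI : IntegrableOn (fun q : ℝ × ℝ => (c / (8 * Real.pi ^ 2)) *
        (Real.exp ((-(2 * κ * c)) * q.1) * Real.cos ((2 * a * c) * q.2))) PS := by
    refine Integrable.const_mul ?_ _
    have := hi1.integrable.mul_prod hi2.integrable
    rw [Measure.prod_restrict] at this
    exact this
  rw [prolate_integral y hy c hc
    (fun r s => amp κ r * amp κ s * Real.cos (a * (r - s))) (cross_integrable κ a hκ y)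
    (hI.congr_fun hE.symm PS_meas), setIntegral_congr_fun PS_meas hE, integral_const_mul, PS,
    Measure.volume_eq_prod,
    setIntegral_prod_mul (fun ξ => Real.exp ((-(2 * κ * c)) * ξ))
      (fun η => Real.cos ((2 * a * c) * η)),
    integral_exp_mul_Ioi (by have := mul_pos hκ hc0; linarith) 1, hc]
  have hJ := cos_int (2 * a * c)
  have habs : |2 * a * c| = 2 * |a| * c := by
    rw [abs_mul, abs_mul, abs_of_pos hc0]; norm_num
  rw [habs] at hJ
  generalize (∫ η in Ioo (-1:ℝ) 1, Real.cos (2 * a * c * η)) = J at hJ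
  have e4 : Real.exp (-(2 * κ * c) * 1) = Real.exp (-(κ * (2 * c))) := by congr 1; ring
  rw [e4]
  have hEp := Real.exp_pos (-(κ * (2 * c)))
  generalize Real.exp (-(κ * (2 * c))) = E at hEp
  have : Real.pi * (c / (8 * Real.pi ^ 2) * (-E / (-(2 * κ * c)) * J)) =
      1 / (8 * Real.pi * κ) * (E * (J / 2)) := by
    field_simp
  rw [this]
  gcongr
  linarith

lemma F_bound (k : ℂ) (hk : 0 < k.im) (y : E3) :
    Integrable (fun x : E3 => ‖gk k (x - y) - gk k x‖ ^ 2) ∧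
    ∫ x : E3, ‖gk k (x - y) - gk k x‖ ^ 2 ≤
      (1 / (4 * Real.pi)) * (1 + |k.re| / (2 * k.im)) * ‖y‖ := by
  by_cases hy : y = 0
  · subst hy; simp
  have h1 := amp_integrable k.im hk
  have h2 : Integrable (fun x : E3 => amp k.im ‖x - y‖ ^ 2) := h1.comp_sub_right y
  have h3 := cross_integrable k.im k.re hk y
  have e : (fun x : E3 => ‖gk k (x - y) - gk k x‖ ^ 2) = fun x =>
      (amp k.im ‖x - y‖ ^ 2 + amp k.im ‖x‖ ^ 2) - 2 *
        (amp k.im ‖x‖ * amp k.im ‖x - y‖ * Real.cos (k.re * (‖x‖ - ‖x - y‖))) := by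
    funext x; rw [gk_diff]; ring
  rw [e]
  have h21 : Integrable (fun x : E3 => amp k.im ‖x - y‖ ^ 2 + amp k.im ‖x‖ ^ 2) := h2.add h1
  refine ⟨h21.sub (h3.const_mul 2), ?_⟩
  have hshift : ∫ x : E3, amp k.im ‖x - y‖ ^ 2 = ∫ x : E3, amp k.im ‖x‖ ^ 2 :=
    integral_sub_right_eq_self (fun x : E3 => amp k.im ‖x‖ ^ 2) y
  rw [integral_sub h21 (h3.const_mul 2), integral_add h2 h1, hshift, amp_integral _ hk,
    integral_const_mul]
  have hl := cross_lower k.im k.re hk y hy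
  have hpi := Real.pi_pos
  have hE1 := Real.add_one_le_exp (-(k.im * ‖y‖))
  have hE2 : Real.exp (-(k.im * ‖y‖)) ≤ 1 := Real.exp_le_one_iff.2 (by
    have := mul_nonneg hk.le (norm_nonneg y); linarith)
  have hay : 0 ≤ |k.re| * ‖y‖ / 2 := by positivity
  set E := Real.exp (-(k.im * ‖y‖))
  have key : 1 - E * (1 - |k.re| * ‖y‖ / 2) ≤ k.im * ‖y‖ + |k.re| * ‖y‖ / 2 := by nlinarith
  calc _ ≤ 2 * (1 / (8 * Real.pi * k.im)) * (1 - E * (1 - |k.re| * ‖y‖ / 2)) := by linarith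
    _ ≤ 2 * (1 / (8 * Real.pi * k.im)) * (k.im * ‖y‖ + |k.re| * ‖y‖ / 2) := by gcongr
    _ = _ := by field_simp; ring

lemma gk_meas (k : ℂ) : Measurable (gk k) := by
  unfold gk; fun_prop

end Aux

/-- For real-valued `V ∈ L¹(ℝ³)` with `∫ |V(x)||x| dx < ∞` and `Im k > 0`, the
operator `(-Δ-k²)⁻¹|V|^{1/2} - |g_k⟩⟨|V|^{1/2}|`, with integral kernel
`(g_k(x-y) - g_k(x))|V(y)|^{1/2}`, is Hilbert–Schmidt with squared Hilbert–Schmidt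
norm (= the `L²(ℝ⁶)`-norm squared of the kernel) at most
`(1/4π)(1 + |Re k|/(2 Im k)) ∫ |V(x)||x| dx`. -/
theorem stmt11 (V : E3 → ℝ) (hV : Integrable V)
    (hVx : Integrable (fun x => |V x| * ‖x‖))
    (k : ℂ) (hk : 0 < k.im) :
    Integrable (fun p : E3 × E3 =>
        ‖(gk k (p.1 - p.2) - gk k p.1) * (Real.sqrt |V p.2| : ℂ)‖ ^ 2) ∧
      ∫ p : E3 × E3, ‖(gk k (p.1 - p.2) - gk k p.1) * (Real.sqrt |V p.2| : ℂ)‖ ^ 2 ≤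
        (1 / (4 * Real.pi)) * (1 + |k.re| / (2 * k.im)) * ∫ x : E3, |V x| * ‖x‖ := by
  have e : (fun p : E3 × E3 => ‖(gk k (p.1 - p.2) - gk k p.1) * (Real.sqrt |V p.2| : ℂ)‖ ^ 2) =
      fun p => ‖gk k (p.1 - p.2) - gk k p.1‖ ^ 2 * |V p.2| := by
    funext p
    rw [norm_mul, mul_pow, Complex.norm_real, Real.norm_eq_abs, sq_abs,
      Real.sq_sqrt (abs_nonneg _)]
  rw [e]
  have hm : Measurable (fun p : E3 × E3 => ‖gk k (p.1 - p.2) - gk k p.1‖ ^ 2) := by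
    have := gk_meas k
    fun_prop
  have hVm : AEStronglyMeasurable (fun p : E3 × E3 => |V p.2|) (volume.prod volume) :=
    hV.abs.aestronglyMeasurable.comp_snd
  have hsm : AEStronglyMeasurable (fun p : E3 × E3 => ‖gk k (p.1 - p.2) - gk k p.1‖ ^ 2 * |V p.2|)
      (volume.prod volume) := hm.aestronglyMeasurable.mul hVm
  have hb : ∀ y : E3, ∫ x : E3, ‖gk k (x - y) - gk k x‖ ^ 2 * |V y| ≤
      (1 / (4 * Real.pi)) * (1 + |k.re| / (2 * k.im)) * (|V y| * ‖y‖) := by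
    intro y
    rw [integral_mul_const]
    have := mul_le_mul_of_nonneg_right (F_bound k hk y).2 (abs_nonneg (V y))
    linarith
  have hb0 : ∀ y : E3, 0 ≤ ∫ x : E3, ‖gk k (x - y) - gk k x‖ ^ 2 * |V y| :=
    fun y => integral_nonneg fun x => by positivity
  have hR := hVx.const_mul ((1 / (4 * Real.pi)) * (1 + |k.re| / (2 * k.im)))
  have hnorm : ∀ y : E3, (∫ x : E3, ‖‖gk k (x - y) - gk k x‖ ^ 2 * |V y|‖) =
      ∫ x : E3, ‖gk k (x - y) - gk k x‖ ^ 2 * |V y| := by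
    intro y
    congr 1; funext x
    exact Real.norm_of_nonneg (by positivity)
  have hint : Integrable (fun p : E3 × E3 => ‖gk k (p.1 - p.2) - gk k p.1‖ ^ 2 * |V p.2|)
      (volume.prod volume) := by
    rw [integrable_prod_iff' hsm]
    refine ⟨Filter.Eventually.of_forall fun y => (F_bound k hk y).1.mul_const |V y|, ?_⟩
    refine hR.mono' hsm.norm.prod_swap.integral_prod_right' ?_
    refine Filter.Eventually.of_forall fun y => ?_
    simp only
    rw [hnorm y, Real.norm_of_nonneg (hb0 y)]
    exact hb y
  refine ⟨hint, ?_⟩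
  rw [Measure.volume_eq_prod, integral_prod_symm _ hint, ← integral_const_mul]
  exact integral_mono hint.integral_prod_right hR hb
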